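/- Let (γ, γ') be a pair of topological circles in ℝ³ forming a Hopf link, let T ⊆ ℝ³ be a solid torus with γ ∪ γ' ⊆ T, and let B = k(B̄(0,1)) for some homeomorphism k : ℝ³ → ℝ³ (a tamely embedded closed topological ball) with γ ∪ γ' ⊆ interior(B). Then there exists a connected set S ⊆ T ∩ B with S ∩ γ ≠ ∅ and S ∩ γ' ≠ ∅; i.e., γ and γ' can be joined inside T ∩ B. -/

import Mathlib

noncomputable section

/-- ℝ³ with the Euclidean metric. -/
abbrev E3 := EuclideanSpace ℝ (Fin 3)

/-- ℝ² with the Euclidean metric. -/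
abbrev E2 := EuclideanSpace ℝ (Fin 2)

/-- The standard round unit circle in the x₁x₂-plane. -/
def C1 : Set E3 := {x | ∃ s : ℝ, x = ![Real.cos s, Real.sin s, 0]}

/-- The standard Hopf partner circle. -/
def C2 : Set E3 := {x | ∃ s : ℝ, x = ![1 + Real.cos s, 0, Real.sin s]}

/-- `(γ, γ')` forms a Hopf link. -/
def HopfLink (γ γ' : Set E3) : Prop :=
  ∃ h : E3 ≃ₜ E3, h '' γ = C1 ∧ h '' γ' = C2

/-- A solid torus: a compact set homeomorphic to `S¹ × D²`. -/
def IsSolidTorus (T : Set E3) : Prop :=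
  IsCompact T ∧
    Nonempty (T ≃ₜ (Metric.sphere (0 : E2) 1 × Metric.closedBall (0 : E2) 1))

open Set Metric

/-- On a preconnected set, two continuous logarithms of the same function differ by a constant. -/
lemma sub_eq_sub_of_exp_eq_exp {X : Type*} [TopologicalSpace X] {s : Set X}
    (hs : IsPreconnected s) {φ ψ : X → ℂ} (hφ : ContinuousOn φ s) (hψ : ContinuousOn ψ s)
    (h : ∀ x ∈ s, Complex.exp (φ x) = Complex.exp (ψ x)) {x y : X} (hx : x ∈ s) (hy : y ∈ s) :
    φ x - ψ x = φ y - ψ y := by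
  have hone : ∀ z ∈ s, Complex.exp (φ z - ψ z) = 1 := fun z hz => by
    rw [Complex.exp_sub, h z hz, div_self (Complex.exp_ne_zero _)]
  refine Complex.isCoveringMap_exp.constOn_of_comp hs (g := fun z => φ z - ψ z)
    (hφ.sub hψ) (fun a ha b hb => ?_) hx hy
  exact Subtype.ext ((hone a ha).trans (hone b hb).symm)

/-- A nonvanishing continuous function on a simply connected, locally path connected space has a
continuous logarithm. -/
lemma exists_continuous_exp_eq {X : Type*} [TopologicalSpace X] [SimplyConnectedSpace X]
    [LocallyPathConnectedSpace X] {f : X → ℂ} (hf : Continuous f) (h0 : ∀ x, f x ≠ 0) :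
    ∃ φ : X → ℂ, Continuous φ ∧ ∀ x, Complex.exp (φ x) = f x := by
  obtain ⟨x₀⟩ : Nonempty X := inferInstance
  obtain ⟨φ, ⟨-, hφ⟩, -⟩ := Complex.isCoveringMap_exp.existsUnique_continuousMap_lifts
    (⟨fun x => ⟨f x, h0 x⟩, by fun_prop⟩ : C(X, {z : ℂ // z ≠ 0})) x₀ (Complex.log (f x₀))
    (Subtype.ext (Complex.exp_log (h0 x₀)))
  exact ⟨φ, φ.continuous, fun x => congrArg Subtype.val (congrFun hφ x)⟩

instance : Fact (Module.finrank ℝ E3 = 2 + 1) := ⟨by simp⟩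

/-- A nonvanishing continuous function on a punctured sphere has a continuous logarithm. -/
lemma exists_continuousOn_exp_eq_compl_singleton {f : sphere (0 : E3) 1 → ℂ} (hf : Continuous f)
    (h0 : ∀ x, f x ≠ 0) (v : sphere (0 : E3) 1) :
    ∃ φ : sphere (0 : E3) 1 → ℂ, ContinuousOn φ {v}ᶜ ∧ ∀ x ≠ v, Complex.exp (φ x) = f x := by
  let e := stereographic' 2 v
  have he : Continuous e.symm := by
    have := e.continuousOn_symm
    rwa [stereographic'_target, continuousOn_univ] at this
  obtain ⟨φ, hφ, hφf⟩ := exists_continuous_exp_eq (hf.comp he) (fun x => h0 _)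
  refine ⟨φ ∘ e, hφ.comp_continuousOn ?_, fun x hx => ?_⟩
  · have := e.continuousOn
    rwa [stereographic'_source] at this
  · have hxs : x ∈ e.source := by rw [stereographic'_source]; exact hx
    simp only [Function.comp_apply, hφf, e.left_inv hxs]

/-- The sphere minus two points is connected. -/
lemma isPreconnected_sphere_compl_pair (v w : sphere (0 : E3) 1) (hvw : w ≠ v) :
    IsPreconnected ({v}ᶜ ∩ {w}ᶜ : Set (sphere (0 : E3) 1)) := by
  let e := stereographic' 2 v
  have he : Continuous e.symm := by
    have := e.continuousOn_symm
    rwa [stereographic'_target, continuousOn_univ] at this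
  have hw : w ∈ e.source := by rw [stereographic'_source]; exact hvw
  have key : ({v}ᶜ ∩ {w}ᶜ : Set (sphere (0 : E3) 1)) = e.symm '' {e w}ᶜ := by
    ext x
    constructor
    · rintro ⟨hxv, hxw⟩
      have hx : x ∈ e.source := by rw [stereographic'_source]; exact hxv
      exact ⟨e x, fun h => hxw (e.injOn hx hw h), e.left_inv hx⟩
    · rintro ⟨y, hy, rfl⟩
      have hyt : y ∈ e.target := by rw [stereographic'_target]; trivial
      have := e.map_target hyt
      rw [stereographic'_source] at this
      refine ⟨this, fun h => hy ?_⟩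
      have h' : e.symm y = w := h
      simp only [mem_singleton_iff, ← h', e.right_inv hyt]
  rw [key]
  exact ((isConnected_compl_singleton_of_one_lt_rank
    (by simp [← Module.finrank_eq_rank]) _).isPreconnected).image _ he.continuousOn

/-- A nonvanishing continuous function on the two-sphere has a continuous logarithm. -/
lemma exists_continuous_exp_eq_sphere {f : sphere (0 : E3) 1 → ℂ} (hf : Continuous f)
    (h0 : ∀ x, f x ≠ 0) :
    ∃ φ : sphere (0 : E3) 1 → ℂ, Continuous φ ∧ ∀ x, Complex.exp (φ x) = f x := by
  classical
  let v : sphere (0 : E3) 1 := ⟨EuclideanSpace.single 0 1, by simp⟩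
  let w : sphere (0 : E3) 1 := ⟨EuclideanSpace.single 1 1, by simp⟩
  let u : sphere (0 : E3) 1 := ⟨EuclideanSpace.single 2 1, by simp⟩
  have ne (i j : Fin 3) (hij : i ≠ j) :
      (EuclideanSpace.single i (1 : ℝ) : E3) ≠ EuclideanSpace.single j 1 := fun h => by
    have := congrArg (fun x : E3 => x i) h
    simp [hij] at this
  have hwv : w ≠ v := fun h => ne 1 0 (by decide) (congrArg Subtype.val h)
  have huv : u ≠ v := fun h => ne 2 0 (by decide) (congrArg Subtype.val h)
  have huw : u ≠ w := fun h => ne 2 1 (by decide) (congrArg Subtype.val h)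
  obtain ⟨φ, hφ, hφf⟩ := exists_continuousOn_exp_eq_compl_singleton hf h0 v
  obtain ⟨ψ, hψ, hψf⟩ := exists_continuousOn_exp_eq_compl_singleton hf h0 w
  set c := φ u - ψ u with hc
  have hexp : Complex.exp c = 1 := by
    rw [hc, Complex.exp_sub, hφf u huv, hψf u huw, div_self (h0 u)]
  have hagree : ∀ x, x ≠ v → x ≠ w → φ x = ψ x + c := fun x hxv hxw => by
    have := sub_eq_sub_of_exp_eq_exp (isPreconnected_sphere_compl_pair v w hwv)
      (hφ.mono inter_subset_left) (hψ.mono inter_subset_right)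
      (fun z hz => (hφf z hz.1).trans (hψf z hz.2).symm) (x := x) (y := u) ⟨hxv, hxw⟩ ⟨huv, huw⟩
    rw [← hc] at this
    rw [← this]; ring
  refine ⟨fun x => if x = v then ψ x + c else φ x, ?_, fun x => ?_⟩
  · rw [← continuousOn_univ]
    have hcover : (univ : Set (sphere (0 : E3) 1)) = {v}ᶜ ∪ {w}ᶜ := by
      ext x
      by_cases hx : x = v
      · simp [hx, hwv.symm]
      · simp [hx]
    rw [hcover]
    refine ContinuousOn.union_of_isOpen (hφ.congr fun x hx => if_neg hx)
      ((hψ.add (continuousOn_const (c := c))).congr fun x hx => ?_)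
      isOpen_compl_singleton isOpen_compl_singleton
    by_cases hxv : x = v
    · exact if_pos hxv
    · exact (if_neg hxv).trans (hagree x hxv hx)
  · by_cases hxv : x = v
    · simp only [if_pos hxv, Complex.exp_add, hexp, mul_one]
      exact hψf x (hxv ▸ hwv.symm)
    · simp only [if_neg hxv, hφf x hxv]

/-- A continuous function on `ℝ³` which does not vanish on an embedded sphere has a continuous
logarithm there, which extends to all of `ℝ³`. -/
lemma exists_continuous_exp_eqOn_image_sphere (k : E3 ≃ₜ E3) {f : E3 → ℂ} (hf : Continuous f)
    (h0 : ∀ x ∈ k '' sphere 0 1, f x ≠ 0) :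
    ∃ φ : E3 → ℂ, Continuous φ ∧ ∀ x ∈ k '' sphere 0 1, Complex.exp (φ x) = f x := by
  obtain ⟨φ, hφ, hφf⟩ := exists_continuous_exp_eq_sphere (f := fun x => f (k x))
    (by fun_prop) (fun x => h0 _ (mem_image_of_mem k x.2))
  obtain ⟨Φ, hΦ⟩ := ContinuousMap.exists_restrict_eq (isClosed_sphere (x := (0 : E3)) (ε := 1))
    (⟨φ, hφ⟩ : C(sphere (0 : E3) 1, ℂ))
  refine ⟨Φ ∘ k.symm, Φ.continuous.comp k.symm.continuous, ?_⟩
  rintro _ ⟨x, hx, rfl⟩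
  have : Φ x = φ ⟨x, hx⟩ := congrArg (fun g => g ⟨x, hx⟩) hΦ
  simp [this, hφf]

/-- If `T` meets the embedded ball `k (B̄(0,1))` in two disjoint closed pieces `A` and `A'`, then a
function without zeros on `A` and on the boundary sphere can be replaced on `T` by a nonvanishing
function agreeing with it on `A` and equal to `1` on `A'`. -/
lemma exists_continuousOn_ne_zero_eq_on_piece (k : E3 ≃ₜ E3) {T A A' : Set E3}
    (hT : IsClosed T) (hA : IsClosed A) (hA' : IsClosed A') (hAA' : Disjoint A A')
    (hunion : T ∩ k '' closedBall 0 1 = A ∪ A') {f : E3 → ℂ} (hf : Continuous f)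
    (h0A : ∀ x ∈ A, f x ≠ 0) (h0 : ∀ x ∈ k '' sphere 0 1, f x ≠ 0) :
    ∃ F : E3 → ℂ, ContinuousOn F T ∧ (∀ x ∈ T, F x ≠ 0) ∧ (∀ x ∈ A, F x = f x) ∧
      ∀ x ∈ A', F x = 1 := by
  classical
  obtain ⟨φ, hφ, hφf⟩ := exists_continuous_exp_eqOn_image_sphere k hf h0
  obtain ⟨u, hu0, hu1, -⟩ := exists_continuous_zero_one_of_isClosed hA' hA hAA'.symm
  let G : E3 → ℂ := fun x => Complex.exp (u x * φ x)
  have hG : Continuous G := by fun_prop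
  let F : E3 → ℂ := fun x => if x ∈ A then f x else if x ∈ A' then 1 else G x
  have hFA : ∀ x ∈ A, F x = f x := fun x hx => if_pos hx
  have hFA' : ∀ x ∈ A', F x = 1 := fun x hx => by
    have : x ∉ A := fun h => disjoint_left.1 hAA' h hx
    simp [F, this, hx]
  have hopen : IsOpen (k '' ball 0 1) := k.isOpenMap _ isOpen_ball
  have hsub : ∀ x ∈ A ∪ A', x ∉ k '' ball 0 1 → x ∈ k '' sphere 0 1 := by
    intro x hx hxb
    rw [← hunion] at hx
    obtain ⟨-, y, hy, rfl⟩ := hx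
    refine ⟨y, ?_, rfl⟩
    have : y ∉ ball (0 : E3) 1 := fun h => hxb ⟨y, h, rfl⟩
    simp only [mem_closedBall, mem_ball, mem_sphere, not_lt] at *
    exact le_antisymm hy this
  have hFG : ∀ x ∈ T ∩ (k '' ball 0 1)ᶜ, F x = G x := by
    rintro x ⟨hxT, hxb⟩
    by_cases hxA : x ∈ A
    · rw [hFA x hxA]
      simp [G, hu1 hxA, hφf x (hsub x (.inl hxA) hxb)]
    · by_cases hxA' : x ∈ A'
      · rw [hFA' x hxA']
        simp [G, hu0 hxA']
      · simp [F, hxA, hxA']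
  refine ⟨F, ?_, fun x hx => ?_, hFA, hFA'⟩
  · have hcover : T ⊆ (A ∪ A') ∪ (T ∩ (k '' ball 0 1)ᶜ) := by
      intro x hx
      by_cases hxb : x ∈ k '' ball 0 1
      · left
        rw [← hunion]
        exact ⟨hx, image_mono ball_subset_closedBall hxb⟩
      · exact .inr ⟨hx, hxb⟩
    refine ContinuousOn.mono ?_ hcover
    refine ContinuousOn.union_of_isClosed (ContinuousOn.union_of_isClosed
      (hf.continuousOn.congr hFA) (continuousOn_const.congr hFA') hA hA')
      (hG.continuousOn.congr hFG) (hA.union hA') (hT.inter hopen.isClosed_compl)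
  · by_cases hxA : x ∈ A
    · rw [hFA x hxA]; exact h0A x hxA
    · by_cases hxA' : x ∈ A'
      · rw [hFA' x hxA']; exact one_ne_zero
      · simp only [F, if_neg hxA, if_neg hxA']
        exact Complex.exp_ne_zero _

/-- A continuous logarithm of a `2π`-periodic function on the infinite solid cylinder changes by a
fixed multiple of `2πi` over a period. -/
lemma exists_int_add_two_pi {Y : Type*} [TopologicalSpace Y] [PreconnectedSpace Y] [Nonempty Y]
    {Φ : ℝ × Y → ℂ} (hΦ : Continuous Φ)
    (hper : ∀ t y, Complex.exp (Φ (t + 2 * Real.pi, y)) = Complex.exp (Φ (t, y))) :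
    ∃ n : ℤ, ∀ t y, Φ (t + 2 * Real.pi, y) = Φ (t, y) + n * (2 * Real.pi * Complex.I) := by
  obtain ⟨y₀⟩ : Nonempty Y := inferInstance
  obtain ⟨n, hn⟩ := Complex.exp_eq_exp_iff_exists_int.1 (hper 0 y₀)
  refine ⟨n, fun t y => ?_⟩
  have := sub_eq_sub_of_exp_eq_exp (isPreconnected_univ (α := ℝ × Y))
    (φ := fun p => Φ (p.1 + 2 * Real.pi, p.2)) (ψ := Φ) (by fun_prop) hΦ.continuousOn
    (fun p _ => hper p.1 p.2) (mem_univ (t, y)) (mem_univ (0, y₀))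
  simp only [hn] at this
  rw [sub_eq_iff_eq_add] at this
  rw [this]; ring

/-- The standard parametrisation of the circle. -/
def circleParam (t : ℝ) : sphere (0 : E2) 1 :=
  ⟨!₂[Real.cos t, Real.sin t], by simp [EuclideanSpace.norm_eq]⟩

lemma continuous_circleParam : Continuous circleParam := by
  unfold circleParam
  refine Continuous.subtype_mk ?_ _
  refine (PiLp.continuous_toLp 2 _).comp (continuous_pi fun i => ?_)
  fin_cases i
  · exact Real.continuous_cos
  · exact Real.continuous_sin

lemma circleParam_add_two_pi (t : ℝ) : circleParam (t + 2 * Real.pi) = circleParam t := by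
  simp [circleParam]

lemma circleParam_eq_iff {s t : ℝ} :
    circleParam s = circleParam t ↔ ∃ n : ℤ, s = t + n * (2 * Real.pi) := by
  constructor
  · intro h
    have h' : (!₂[Real.cos s, Real.sin s] : E2) = !₂[Real.cos t, Real.sin t] :=
      congrArg Subtype.val h
    have hc : Real.cos s = Real.cos t := congrArg (fun x : E2 => x 0) h'
    have hs : Real.sin s = Real.sin t := congrArg (fun x : E2 => x 1) h'
    obtain ⟨n, hn⟩ := (Real.Angle.angle_eq_iff_two_pi_dvd_sub).1
      (Real.Angle.cos_sin_inj hc hs)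
    exact ⟨n, by linarith⟩
  · rintro ⟨n, rfl⟩
    simp [circleParam, Real.cos_add_int_mul_two_pi, Real.sin_add_int_mul_two_pi]

lemma exists_circleParam_eq (z : sphere (0 : E2) 1) :
    ∃ t ∈ Icc 0 (2 * Real.pi), circleParam t = z := by
  obtain ⟨z, hz⟩ := z
  have hz' : z 0 ^ 2 + z 1 ^ 2 = 1 := by
    have := EuclideanSpace.real_norm_sq_eq z
    rw [mem_sphere_zero_iff_norm.1 hz, Fin.sum_univ_two] at this
    linarith
  set w : ℂ := ⟨z 0, z 1⟩ with hw
  have hnorm : ‖w‖ = 1 := by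
    rw [Complex.norm_eq_sqrt_sq_add_sq, hz', Real.sqrt_one]
  have hcos : Real.cos w.arg = z 0 := by
    rw [Complex.cos_arg (by rintro h; simp [h] at hnorm), hnorm]; simp [hw]
  have hsin : Real.sin w.arg = z 1 := by
    rw [Complex.sin_arg, hnorm]; simp [hw]
  have hz2 : circleParam w.arg = ⟨z, hz⟩ := by
    refine Subtype.ext ?_
    ext i
    fin_cases i
    · exact hcos
    · exact hsin
  by_cases h : 0 ≤ w.arg
  · exact ⟨w.arg, ⟨h, by linarith [Complex.arg_le_pi w, Real.pi_pos]⟩, hz2⟩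
  · exact ⟨w.arg + 2 * Real.pi, ⟨by linarith [Complex.neg_pi_lt_arg w, Real.pi_pos], by linarith⟩,
      by rw [circleParam_add_two_pi, hz2]⟩

/-- A nonvanishing function on the standard solid torus has a continuous logarithm on the
universal cover. -/
lemma exists_log_on_cover {F : sphere (0 : E2) 1 × closedBall (0 : E2) 1 → ℂ}
    (hF : Continuous F) (h0 : ∀ p, F p ≠ 0) :
    ∃ Φ : ℝ × closedBall (0 : E2) 1 → ℂ, Continuous Φ ∧
      ∀ t y, Complex.exp (Φ (t, y)) = F (circleParam t, y) := by
  let r : E2 → closedBall (0 : E2) 1 := fun x => ⟨(max 1 ‖x‖)⁻¹ • x, by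
    have h1 : (1 : ℝ) ≤ max 1 ‖x‖ := le_max_left _ _
    rw [mem_closedBall_zero_iff, norm_smul, norm_inv, Real.norm_of_nonneg (by linarith),
      inv_mul_le_iff₀ (by linarith), mul_one]
    exact le_max_right _ _⟩
  have hr : Continuous r := by
    have hmax : Continuous fun x : E2 => max 1 ‖x‖ := by fun_prop
    refine Continuous.subtype_mk (Continuous.smul (hmax.inv₀ fun x => ?_) continuous_id) _
    exact (lt_of_lt_of_le one_pos (le_max_left _ _)).ne'
  have hr1 : ∀ y : closedBall (0 : E2) 1, r y = y := fun y => by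
    refine Subtype.ext ?_
    have : ‖(y : E2)‖ ≤ 1 := mem_closedBall_zero_iff.1 y.2
    simp [r, max_eq_left this]
  have := continuous_circleParam
  obtain ⟨Φ, hΦ, hΦF⟩ := exists_continuous_exp_eq (X := ℝ × E2)
    (f := fun p => F (circleParam p.1, r p.2)) (by fun_prop) (fun p => h0 _)
  exact ⟨fun p => Φ (p.1, p.2), by fun_prop, fun t y => by rw [hΦF, hr1]⟩

/-- A `2π`-periodic continuous function on the universal cover of the standard solid torus
descends. -/
lemma exists_continuous_descend {Ψ : ℝ × closedBall (0 : E2) 1 → ℂ} (hΨ : Continuous Ψ)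
    (hper : ∀ t y, Ψ (t + 2 * Real.pi, y) = Ψ (t, y)) :
    ∃ φ : sphere (0 : E2) 1 × closedBall (0 : E2) 1 → ℂ, Continuous φ ∧
      ∀ t y, φ (circleParam t, y) = Ψ (t, y) := by
  have hinv : ∀ s t y, circleParam s = circleParam t → Ψ (s, y) = Ψ (t, y) := by
    intro s t y h
    obtain ⟨n, rfl⟩ := circleParam_eq_iff.1 h
    exact (show Function.Periodic (fun t => Ψ (t, y)) (2 * Real.pi) from
      fun t => hper t y).int_mul n t
  let q : Icc 0 (2 * Real.pi) × closedBall (0 : E2) 1 →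
      sphere (0 : E2) 1 × closedBall (0 : E2) 1 := fun p => (circleParam p.1, p.2)
  have hcp := continuous_circleParam
  have hq : Continuous q := by fun_prop
  have hsurj : Function.Surjective q := fun p => by
    obtain ⟨t, ht, hp⟩ := exists_circleParam_eq p.1
    exact ⟨(⟨t, ht⟩, p.2), Prod.ext hp rfl⟩
  have : CompactSpace (closedBall (0 : E2) 1) :=
    isCompact_iff_compactSpace.1 (isCompact_closedBall _ _)
  have hquot := hq.isClosedMap.isQuotientMap hq hsurj
  choose τ hτ using fun z => exists_circleParam_eq z
  have key : ∀ t y, Ψ (τ (circleParam t), y) = Ψ (t, y) := fun t y => hinv _ _ _ (hτ _).2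
  refine ⟨fun p => Ψ (τ p.1, p.2), ?_, key⟩
  rw [hquot.continuous_iff]
  exact (show Continuous fun p : Icc 0 (2 * Real.pi) × closedBall (0 : E2) 1 =>
    Ψ ((p.1 : ℝ), p.2) by fun_prop).congr fun p => (key _ _).symm

/-- The first cohomology of a solid torus has rank one: any two nonvanishing functions have a
nontrivial multiplicative combination admitting a continuous logarithm. -/
lemma exists_zpow_mul_zpow_eq_exp {X : Type*} [TopologicalSpace X]
    (e : X ≃ₜ sphere (0 : E2) 1 × closedBall (0 : E2) 1) {F G : X → ℂ}
    (hF : Continuous F) (hG : Continuous G) (hF0 : ∀ x, F x ≠ 0) (hG0 : ∀ x, G x ≠ 0) :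
    ∃ m n : ℤ, (m ≠ 0 ∨ n ≠ 0) ∧ ∃ φ : X → ℂ, Continuous φ ∧
      ∀ x, Complex.exp (φ x) = F x ^ m * G x ^ n := by
  obtain ⟨Φ, hΦ, hΦF⟩ := exists_log_on_cover (hF.comp e.symm.continuous) (fun p => hF0 _)
  obtain ⟨Γ, hΓ, hΓG⟩ := exists_log_on_cover (hG.comp e.symm.continuous) (fun p => hG0 _)
  have : PreconnectedSpace (closedBall (0 : E2) 1) :=
    isPreconnected_iff_preconnectedSpace.1 (convex_closedBall _ _).isPreconnected
  have : Nonempty (closedBall (0 : E2) 1) := ⟨⟨0, by simp⟩⟩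
  obtain ⟨a, ha⟩ := exists_int_add_two_pi hΦ (fun t y => by
    rw [hΦF, hΦF, circleParam_add_two_pi])
  obtain ⟨b, hb⟩ := exists_int_add_two_pi hΓ (fun t y => by
    rw [hΓG, hΓG, circleParam_add_two_pi])
  obtain ⟨m, n, hmn, hab⟩ : ∃ m n : ℤ, (m ≠ 0 ∨ n ≠ 0) ∧ m * a + n * b = 0 := by
    by_cases h : a = 0
    · exact ⟨1, 0, by simp, by simp [h]⟩
    · exact ⟨b, -a, by simp [h], by ring⟩
  have habC : (m : ℂ) * a + n * b = 0 := by exact_mod_cast hab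
  obtain ⟨φ, hφ, hφΨ⟩ := exists_continuous_descend
    (Ψ := fun p => m * Φ p + n * Γ p) (by fun_prop) (fun t y => by
      rw [ha, hb]
      linear_combination (2 * Real.pi * Complex.I) * habC)
  refine ⟨m, n, hmn, φ ∘ e, hφ.comp e.continuous, fun x => ?_⟩
  obtain ⟨t, -, ht⟩ := exists_circleParam_eq (e x).1
  have hx : (circleParam t, (e x).2) = e x := Prod.ext ht rfl
  rw [Function.comp_apply, ← hx, hφΨ, Complex.exp_add, Complex.exp_int_mul, Complex.exp_int_mul,
    hΦF, hΓG, hx]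
  simp

/-- A closed plane curve winding once around the origin. -/
def windingCurve (s : ℝ) : ℂ :=
  ⟨Real.cos s ^ 2 + 2 * Real.cos s, Real.sin s⟩

/-- No nonzero power of `windingCurve` has a logarithm which is continuous on the circle. -/
lemma eq_zero_of_exp_eq_windingCurve_zpow {φ : ℝ → ℂ} (hφ : Continuous φ)
    (hper : φ (2 * Real.pi) = φ 0) {m : ℤ}
    (h : ∀ s, Complex.exp (φ s) = windingCurve s ^ m) : m = 0 := by
  have hslit : ∀ s, windingCurve s * Complex.exp (-(s * Complex.I)) ∈ Complex.slitPlane := by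
    intro s
    left
    have : (windingCurve s * Complex.exp (-(s * Complex.I))).re =
        1 + Real.cos s ^ 2 * (1 + Real.cos s) := by
      rw [← neg_mul, ← Complex.ofReal_neg, Complex.mul_re, Complex.exp_ofReal_mul_I_re,
        Complex.exp_ofReal_mul_I_im, Real.cos_neg, Real.sin_neg]
      simp only [windingCurve]
      linear_combination Real.sin_sq_add_cos_sq s
    rw [this]
    have := Real.neg_one_le_cos s
    have := mul_nonneg (sq_nonneg (Real.cos s)) (by linarith : 0 ≤ 1 + Real.cos s)
    linarith
  have hcurve : Continuous windingCurve := by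
    have : windingCurve = fun s : ℝ =>
        ((Real.cos s ^ 2 + 2 * Real.cos s : ℝ) : ℂ) + (Real.sin s : ℝ) * Complex.I := by
      ext s
      exact Complex.mk_eq_add_mul_I _ _
    rw [this]
    fun_prop
  let ψ : ℝ → ℂ := fun s =>
    s * Complex.I + Complex.log (windingCurve s * Complex.exp (-(s * Complex.I)))
  have hψ : Continuous ψ :=
    (by fun_prop : Continuous fun s : ℝ => (s : ℂ) * Complex.I).add
      (Continuous.clog (by fun_prop) hslit)
  have hψexp : ∀ s, Complex.exp (ψ s) = windingCurve s := fun s => by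
    rw [Complex.exp_add, Complex.exp_log (Complex.slitPlane_ne_zero (hslit s)), mul_left_comm,
      ← Complex.exp_add, add_neg_cancel, Complex.exp_zero, mul_one]
  have hcurve_per : windingCurve (2 * Real.pi) = windingCurve 0 := by simp [windingCurve]
  have hψper : ψ (2 * Real.pi) = ψ 0 + 2 * Real.pi * Complex.I := by
    simp only [ψ, hcurve_per, Complex.exp_neg]
    push_cast
    rw [Complex.exp_two_pi_mul_I]
    simp [add_comm]
  have key := sub_eq_sub_of_exp_eq_exp (isPreconnected_univ (α := ℝ)) (φ := fun s => m * ψ s)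
    (by fun_prop) hφ.continuousOn
    (fun s _ => by rw [Complex.exp_int_mul, hψexp, h]) (mem_univ (2 * Real.pi)) (mem_univ 0)
  simp only [hψper, hper] at key
  have hm : (m : ℂ) * (2 * Real.pi * Complex.I) = 0 := by linear_combination key
  simpa [Complex.two_pi_I_ne_zero, Real.pi_ne_zero] using hm

/-- Two connected subsets of a compact set `K` which cannot be joined by a connected subset of `K`
are separated by a partition of `K` into two closed pieces. -/
lemma exists_closed_separation {X : Type*} [TopologicalSpace X] [T2Space X] {K γ γ' : Set X}
    (hK : IsCompact K) (hγ : IsConnected γ) (hγ' : IsConnected γ') (hγK : γ ⊆ K) (hγ'K : γ' ⊆ K)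
    (h : ¬ ∃ S ⊆ K, IsConnected S ∧ (S ∩ γ).Nonempty ∧ (S ∩ γ').Nonempty) :
    ∃ A A' : Set X, IsClosed A ∧ IsClosed A' ∧ Disjoint A A' ∧ K = A ∪ A' ∧ γ ⊆ A ∧ γ' ⊆ A' := by
  have : CompactSpace K := isCompact_iff_compactSpace.1 hK
  obtain ⟨x, hx⟩ := hγ.nonempty
  obtain ⟨y, hy⟩ := hγ'.nonempty
  have hxy : (⟨y, hγ'K hy⟩ : K) ∉ connectedComponent (⟨x, hγK hx⟩ : K) := fun hmem => h
    ⟨Subtype.val '' connectedComponent (⟨x, hγK hx⟩ : K), Subtype.coe_image_subset _ _,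
      isConnected_connectedComponent.image _ continuous_subtype_val.continuousOn,
      ⟨x, ⟨_, mem_connectedComponent, rfl⟩, hx⟩, ⟨y, ⟨_, hmem, rfl⟩, hy⟩⟩
  rw [connectedComponent_eq_iInter_isClopen, mem_iInter] at hxy
  push Not at hxy
  obtain ⟨⟨Z, hZ, hxZ⟩, hyZ⟩ := hxy
  have hpre : ∀ {c : Set X}, IsConnected c → c ⊆ K →
      IsPreconnected (Subtype.val ⁻¹' c : Set K) := fun {c} hc hcK => by
    rw [← Topology.IsInducing.subtypeVal.isPreconnected_image,
      image_preimage_eq_of_subset (by simpa using hcK)]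
    exact hc.isPreconnected
  have hsub : (Subtype.val ⁻¹' γ : Set K) ⊆ Z :=
    (hpre hγ hγK).subset_isClopen hZ ⟨_, hx, hxZ⟩
  have hsub' : (Subtype.val ⁻¹' γ' : Set K) ⊆ Zᶜ :=
    (hpre hγ' hγ'K).subset_isClopen hZ.compl ⟨⟨y, hγ'K hy⟩, hy, hyZ⟩
  refine ⟨Subtype.val '' Z, Subtype.val '' Zᶜ,
    hK.isClosed.isClosedMap_subtype_val _ hZ.isClosed,
    hK.isClosed.isClosedMap_subtype_val _ hZ.compl.isClosed,
    (disjoint_image_iff Subtype.val_injective).2 disjoint_compl_right, ?_,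
    fun z hz => ⟨⟨z, hγK hz⟩, hsub hz, rfl⟩, fun z hz => ⟨⟨z, hγ'K hz⟩, hsub' hz, rfl⟩⟩
  rw [← image_union, union_compl_self, image_univ, Subtype.range_coe]

/-- A function on `ℝ³` vanishing exactly on `C2`, and winding once along `C1`. -/
def linkFun₂ (x : E3) : ℂ := ⟨(x 0 - 1) ^ 2 + x 2 ^ 2 - 1, x 1⟩

/-- A function on `ℝ³` vanishing exactly on `C1`, and winding once along `C2`. -/
def linkFun₁ (x : E3) : ℂ := ⟨x 0 ^ 2 + x 1 ^ 2 - 1, x 2⟩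

lemma continuous_linkFun₁ : Continuous linkFun₁ := by
  have : linkFun₁ = fun x : E3 =>
      ((x 0 ^ 2 + x 1 ^ 2 - 1 : ℝ) : ℂ) + (x 2 : ℝ) * Complex.I :=
    funext fun x => Complex.mk_eq_add_mul_I _ _
  rw [this]
  fun_prop

lemma continuous_linkFun₂ : Continuous linkFun₂ := by
  have : linkFun₂ = fun x : E3 =>
      (((x 0 - 1) ^ 2 + x 2 ^ 2 - 1 : ℝ) : ℂ) + (x 1 : ℝ) * Complex.I :=
    funext fun x => Complex.mk_eq_add_mul_I _ _
  rw [this]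
  fun_prop

lemma exists_cos_sin_eq {a b : ℝ} (h : a ^ 2 + b ^ 2 = 1) :
    ∃ s : ℝ, a = Real.cos s ∧ b = Real.sin s := by
  obtain ⟨s, -, hs⟩ := exists_circleParam_eq ⟨!₂[a, b], by simp [EuclideanSpace.norm_eq, h]⟩
  have hs' : (!₂[Real.cos s, Real.sin s] : E2) = !₂[a, b] := congrArg Subtype.val hs
  exact ⟨s, (congrArg (fun x : E2 => x 0) hs').symm, (congrArg (fun x : E2 => x 1) hs').symm⟩

lemma mem_C1_of_linkFun₁_eq_zero {x : E3} (h : linkFun₁ x = 0) : x ∈ C1 := by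
  have hre : x 0 ^ 2 + x 1 ^ 2 - 1 = 0 := congrArg Complex.re h
  have him : x 2 = 0 := congrArg Complex.im h
  obtain ⟨s, h0, h1⟩ := exists_cos_sin_eq (sub_eq_zero.1 hre)
  refine ⟨s, funext fun i => ?_⟩
  fin_cases i
  · exact h0
  · exact h1
  · exact him

lemma mem_C2_of_linkFun₂_eq_zero {x : E3} (h : linkFun₂ x = 0) : x ∈ C2 := by
  have hre : (x 0 - 1) ^ 2 + x 2 ^ 2 - 1 = 0 := congrArg Complex.re h
  have him : x 1 = 0 := congrArg Complex.im h
  obtain ⟨s, h0, h1⟩ := exists_cos_sin_eq (sub_eq_zero.1 hre)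
  refine ⟨s, funext fun i => ?_⟩
  fin_cases i
  · exact (eq_add_of_sub_eq' h0)
  · exact him
  · exact h1

/-- A parametrisation of `C1`. -/
def paramC1 (s : ℝ) : E3 := !₂[-Real.cos s, Real.sin s, 0]

/-- A parametrisation of `C2`. -/
def paramC2 (s : ℝ) : E3 := !₂[1 + Real.cos s, 0, Real.sin s]

lemma continuous_paramC1 : Continuous paramC1 := by
  refine (PiLp.continuous_toLp 2 _).comp (continuous_pi fun i => ?_)
  fin_cases i
  · exact Real.continuous_cos.neg
  · exact Real.continuous_sin
  · exact continuous_const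

lemma continuous_paramC2 : Continuous paramC2 := by
  refine (PiLp.continuous_toLp 2 _).comp (continuous_pi fun i => ?_)
  fin_cases i
  · exact continuous_const.add Real.continuous_cos
  · exact continuous_const
  · exact Real.continuous_sin

lemma range_paramC1 : range paramC1 = C1 := by
  ext x
  constructor
  · rintro ⟨s, rfl⟩
    exact ⟨Real.pi - s, by simp [paramC1, Real.cos_pi_sub, Real.sin_pi_sub]⟩
  · rintro ⟨s, hs⟩
    refine ⟨Real.pi - s, ?_⟩
    ext i
    rw [hs]
    simp [paramC1, Real.cos_pi_sub, Real.sin_pi_sub]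

lemma range_paramC2 : range paramC2 = C2 := by
  ext x
  constructor
  · rintro ⟨s, rfl⟩
    exact ⟨s, rfl⟩
  · rintro ⟨s, hs⟩
    refine ⟨s, ?_⟩
    ext i
    rw [hs]
    rfl

lemma linkFun₂_paramC1 (s : ℝ) : linkFun₂ (paramC1 s) = windingCurve s := by
  apply Complex.ext
  · simp [linkFun₂, paramC1, windingCurve]; ring
  · simp [linkFun₂, paramC1, windingCurve]

lemma linkFun₁_paramC2 (s : ℝ) : linkFun₁ (paramC2 s) = windingCurve s := by
  apply Complex.ext
  · simp [linkFun₁, paramC2, windingCurve]; ring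
  · simp [linkFun₁, paramC2, windingCurve]

/-- A Hopf link contained in a solid torus `T` and in the interior of a tamely
embedded closed ball `B` can be joined by a connected set inside `T ∩ B`. -/
theorem hopf_link_joined_in_torus_inter_ball
    (γ γ' : Set E3) (hlink : HopfLink γ γ')
    (T : Set E3) (hT : IsSolidTorus T) (hγT : γ ∪ γ' ⊆ T)
    (k : E3 ≃ₜ E3) (B : Set E3) (hB : B = k '' Metric.closedBall 0 1)
    (hint : γ ∪ γ' ⊆ interior B) :
    ∃ S ⊆ T ∩ B, IsConnected S ∧ (S ∩ γ).Nonempty ∧ (S ∩ γ').Nonempty := by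
  obtain ⟨h, h1, h2⟩ := hlink
  have hγ_eq : γ = range (h.symm ∘ paramC1) := by
    rw [range_comp, range_paramC1, ← h1, ← image_comp, h.symm_comp_self, image_id]
  have hγ'_eq : γ' = range (h.symm ∘ paramC2) := by
    rw [range_comp, range_paramC2, ← h2, ← image_comp, h.symm_comp_self, image_id]
  have hc1 : Continuous (h.symm ∘ paramC1) := h.symm.continuous.comp continuous_paramC1
  have hc2 : Continuous (h.symm ∘ paramC2) := h.symm.continuous.comp continuous_paramC2
  have hBcompact : IsCompact B := hB ▸ (isCompact_closedBall (0 : E3) 1).image k.continuous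
  by_contra hcon
  obtain ⟨A, A', hA, hA', hAA', hunion, hγA, hγ'A'⟩ :=
    exists_closed_separation (hT.1.inter hBcompact)
      (hγ_eq ▸ isConnected_range hc1) (hγ'_eq ▸ isConnected_range hc2)
      (fun x hx => ⟨hγT (.inl hx), interior_subset (hint (.inl hx))⟩)
      (fun x hx => ⟨hγT (.inr hx), interior_subset (hint (.inr hx))⟩) hcon
  have hsphere : ∀ x ∈ k '' sphere 0 1, x ∉ γ ∪ γ' := by
    rintro _ ⟨y, hy, rfl⟩ hmem
    have := hint hmem
    rw [hB, ← k.image_interior, interior_closedBall _ one_ne_zero] at this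
    obtain ⟨z, hz, hzy⟩ := this
    rw [k.injective hzy, mem_ball, mem_sphere.1 hy] at hz
    exact lt_irrefl _ hz
  have hf0 : ∀ x, linkFun₂ (h x) = 0 → x ∈ γ' := fun x hx => by
    have := mem_C2_of_linkFun₂_eq_zero hx
    rwa [← h2, h.injective.mem_set_image] at this
  have hg0 : ∀ x, linkFun₁ (h x) = 0 → x ∈ γ := fun x hx => by
    have := mem_C1_of_linkFun₁_eq_zero hx
    rwa [← h1, h.injective.mem_set_image] at this
  rw [hB] at hunion
  obtain ⟨F, hF, hF0, hFA, hFA'⟩ := exists_continuousOn_ne_zero_eq_on_piece k hT.1.isClosed hA hA'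
    hAA' hunion (continuous_linkFun₂.comp h.continuous)
    (fun x hx hx0 => disjoint_left.1 hAA' hx (hγ'A' (hf0 x hx0)))
    (fun x hx hx0 => hsphere x hx (.inr (hf0 x hx0)))
  obtain ⟨G, hG, hG0, hGA', hGA⟩ := exists_continuousOn_ne_zero_eq_on_piece k hT.1.isClosed hA' hA
    hAA'.symm (hunion.trans (union_comm _ _)) (continuous_linkFun₁.comp h.continuous)
    (fun x hx hx0 => disjoint_left.1 hAA' (hγA (hg0 x hx0)) hx)
    (fun x hx hx0 => hsphere x hx (.inl (hg0 x hx0)))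
  obtain ⟨e⟩ := hT.2
  obtain ⟨m, n, hmn, φ, hφ, hφFG⟩ := exists_zpow_mul_zpow_eq_exp e
    (continuousOn_iff_continuous_domRestrict.1 hF) (continuousOn_iff_continuous_domRestrict.1 hG)
    (fun x => hF0 x x.2) (fun x => hG0 x x.2)
  have hm1 : ∀ s, h.symm (paramC1 s) ∈ γ := fun s => hγ_eq ▸ mem_range_self s
  have hm2 : ∀ s, h.symm (paramC2 s) ∈ γ' := fun s => hγ'_eq ▸ mem_range_self s
  have hm : m = 0 := by
    refine eq_zero_of_exp_eq_windingCurve_zpow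
      (φ := fun s => φ ⟨h.symm (paramC1 s), hγT (.inl (hm1 s))⟩)
      (hφ.comp (hc1.subtype_mk _)) (by simp [paramC1]) (fun s => ?_)
    simp [hφFG, hFA _ (hγA (hm1 s)), hGA _ (hγA (hm1 s)), linkFun₂_paramC1]
  have hn : n = 0 := by
    refine eq_zero_of_exp_eq_windingCurve_zpow
      (φ := fun s => φ ⟨h.symm (paramC2 s), hγT (.inr (hm2 s))⟩)
      (hφ.comp (hc2.subtype_mk _)) (by simp [paramC2]) (fun s => ?_)
    simp [hφFG, hGA' _ (hγ'A' (hm2 s)), hFA' _ (hγ'A' (hm2 s)), linkFun₁_paramC2]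
  exact hmn.elim (· hm) (· hn)
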